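/- Let C ⊆ ℝ^d be a convex set that has an ε-MILEF of complexity (m,k) with k ≥ 1, for some ε ≥ 0. Then for every δ > 0, C has an (ε + δ + 2εδ)-LEF of size at most (m+1)·(1 + ((1+δ)/δ)·Flt(k))^k. -/

import Mathlib

open scoped ENNReal Pointwise

/-- The relative distance between two sets `A ⊆ B ⊆ ℝ^ι`:
`rdist(A,B) = sup_{π linear} d_H(π(A),π(B)) / diam(π(A))`, computed in `ℝ≥0∞`,
so that a fraction with `∞` in the denominator as well as `0/0` is `0`,
`rdist(∅,∅) = 0` and `rdist(∅,B) = ∞` for `B ≠ ∅`. -/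
noncomputable def relDist {ι : Type*} (A B : Set (ι → ℝ)) : ℝ≥0∞ :=
  ⨆ π : (ι → ℝ) →ₗ[ℝ] ℝ,
    (⨆ b ∈ B, ⨅ a ∈ A, ENNReal.ofReal |π b - π a|) /
      (⨆ a ∈ A, ⨆ a' ∈ A, ENNReal.ofReal |π a - π a'|)

/-- A point of `ℝ^k` all of whose coordinates are integers. -/
def IsLatticePoint {k : ℕ} (z : Fin k → ℝ) : Prop := ∀ i, ∃ n : ℤ, z i = (n : ℝ)

/-- `Q` is a polyhedron given as the intersection of an affine subspace with at most `m`
closed halfspaces (`m` serving as the number of facets). -/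
def IsPolyhedronOfSize {ι : Type*} (Q : Set (ι → ℝ)) (m : ℕ) : Prop :=
  ∃ (S : AffineSubspace ℝ (ι → ℝ)) (nh : ℕ), nh ≤ m ∧
    ∃ (f : Fin nh → ((ι → ℝ) →ₗ[ℝ] ℝ)) (b : Fin nh → ℝ),
      Q = (S : Set (ι → ℝ)) ∩ {x | ∀ i, f i x ≤ b i}

/-- `Q` is a polyhedron. -/
def IsPolyhedron {ι : Type*} (Q : Set (ι → ℝ)) : Prop := ∃ m, IsPolyhedronOfSize Q m

/-- `C` admits an `ε`-LEF of size `m`: a polyhedron `Q ⊆ ℝ^ℓ` with at most `m` facets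
and an affine map `π` with `C ⊆ π(Q)` and `rdist(C, π(Q)) ≤ ε`. -/
def IsLEF {ι : Type*} (C : Set (ι → ℝ)) (ε : ℝ) (m : ℕ) : Prop :=
  ∃ (l : ℕ) (Q : Set (Fin l → ℝ)) (π : (Fin l → ℝ) →ᵃ[ℝ] (ι → ℝ)),
    IsPolyhedronOfSize Q m ∧ C ⊆ π '' Q ∧ relDist C (π '' Q) ≤ ENNReal.ofReal ε

/-- `C` admits an `ε`-MILEF of complexity `(m, k)`: a polyhedron `Q ⊆ ℝ^ℓ` with at most `m`
facets together with affine maps `σ : ℝ^ℓ → ℝ^k` and `π : ℝ^ℓ → ℝ^ι` such that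
`C̄ := conv(π(Q ∩ σ⁻¹(ℤ^k)))` satisfies `C ⊆ C̄` and `rdist(C, C̄) ≤ ε`. -/
def IsMILEF {ι : Type*} (C : Set (ι → ℝ)) (ε : ℝ) (m k : ℕ) : Prop :=
  ∃ (l : ℕ) (Q : Set (Fin l → ℝ)) (σ : (Fin l → ℝ) →ᵃ[ℝ] (Fin k → ℝ))
    (π : (Fin l → ℝ) →ᵃ[ℝ] (ι → ℝ)),
    IsPolyhedronOfSize Q m ∧
    C ⊆ convexHull ℝ (π '' (Q ∩ {x | IsLatticePoint (σ x)})) ∧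
    relDist C (convexHull ℝ (π '' (Q ∩ {x | IsLatticePoint (σ x)}))) ≤ ENNReal.ofReal ε

/-- The lattice width of a set `B ⊆ ℝ^k`:
`width(B) = inf_{v ∈ ℤ^k \ {0}} (sup_{x ∈ B} vᵀx - inf_{x ∈ B} vᵀx)`, in `ℝ≥0∞`. -/
noncomputable def latticeWidth {k : ℕ} (B : Set (Fin k → ℝ)) : ℝ≥0∞ :=
  ⨅ v ∈ {v : Fin k → ℤ | v ≠ 0},
    ⨆ x ∈ B, ⨆ y ∈ B, ENNReal.ofReal (∑ i, (v i : ℝ) * (x i - y i))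

/-- The flatness constant `Flt(k)`: the smallest `λ` bounding the lattice width of every
convex, closed, full-dimensional and lattice-free subset of `ℝ^k`. -/
noncomputable def flatnessConst (k : ℕ) : ℝ≥0∞ :=
  ⨆ B ∈ {B : Set (Fin k → ℝ) | Convex ℝ B ∧ IsClosed B ∧ affineSpan ℝ B = ⊤ ∧
      ∀ x ∈ B, ¬ IsLatticePoint x}, latticeWidth B

/-- The linear form `x ↦ vᵀx` on `ℝ^k` given by an integer vector `v`. -/
def intForm {k : ℕ} (v : Fin k → ℤ) : (Fin k → ℝ) →ₗ[ℝ] ℝ :=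
  ∑ i, (v i : ℝ) • LinearMap.proj i

lemma intForm_apply {k : ℕ} (v : Fin k → ℤ) (x : Fin k → ℝ) :
    intForm v x = ∑ i, (v i : ℝ) * x i := by
  simp [intForm]

lemma IsLatticePoint.exists_intCast {k : ℕ} {x : Fin k → ℝ} (hx : IsLatticePoint x) :
    ∃ z : Fin k → ℤ, x = fun i => (z i : ℝ) := by
  choose z hz using hx
  exact ⟨z, funext hz⟩

lemma IsLatticePoint.exists_intForm_eq {k : ℕ} {x : Fin k → ℝ} (hx : IsLatticePoint x)
    (v : Fin k → ℤ) : ∃ n : ℤ, intForm v x = n := by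
  obtain ⟨z, rfl⟩ := hx.exists_intCast
  exact ⟨∑ i, v i * z i, by simp [intForm_apply]⟩

/-- A nonzero integer vector is, up to an integer factor, the first member of a basis of the dual
lattice. -/
lemma exists_basis_coord {k : ℕ} {v : Fin (k + 1) → ℤ} (hv : v ≠ 0) :
    ∃ (b : Module.Basis (Fin (k + 1)) ℤ (Fin (k + 1) → ℤ)) (g : ℤ), g ≠ 0 ∧
      ∀ z, v ⬝ᵥ z = g * b.equivFun z 0 := by
  set f : (Fin (k + 1) → ℤ) →ₗ[ℤ] ℤ := dotProductBilin ℤ ℤ v with hf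
  have hfa : ∀ z, f z = v ⬝ᵥ z := fun z => rfl
  obtain ⟨g, hg⟩ := (IsPrincipalIdealRing.principal (LinearMap.range f)).principal
  have hdvd : ∀ z, ∃ c, f z = c * g := fun z => by
    have : f z ∈ LinearMap.range f := ⟨z, rfl⟩
    rw [hg] at this
    obtain ⟨c, hc⟩ := Submodule.mem_span_singleton.1 this
    exact ⟨c, by rw [← hc, smul_eq_mul]⟩
  have hg0 : g ≠ 0 := by
    rintro rfl
    apply hv
    ext i
    obtain ⟨c, hc⟩ := hdvd (Pi.single i 1)
    simpa [hfa] using hc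
  obtain ⟨z₁, hz₁⟩ : ∃ z₁, f z₁ = g := by
    have : g ∈ LinearMap.range f := by rw [hg]; exact Submodule.mem_span_singleton_self g
    exact this
  obtain ⟨n, ⟨bk⟩⟩ := Submodule.nonempty_basis_of_pid (Pi.basisFun ℤ (Fin (k + 1)))
    (LinearMap.ker f)
  have hli : ∀ (c : ℤ), ∀ x ∈ LinearMap.ker f, c • z₁ + x = 0 → c = 0 := by
    intro c x hx h
    have := congrArg f h
    rw [map_add, map_smul, hz₁, LinearMap.mem_ker.1 hx, map_zero, add_zero, smul_eq_mul] at this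
    exact (mul_eq_zero.1 this).resolve_right hg0
  have hsp : ∀ z, ∃ c : ℤ, z + c • z₁ ∈ LinearMap.ker f := by
    intro z
    obtain ⟨c, hc⟩ := hdvd z
    refine ⟨-c, ?_⟩
    rw [LinearMap.mem_ker, map_add, map_smul, hz₁, hc, smul_eq_mul]
    ring
  have hn : n = k := by
    have := Fintype.card_congr
      ((Module.Basis.mkFinCons z₁ bk hli hsp).indexEquiv (Pi.basisFun ℤ (Fin (k + 1))))
    simpa using this
  subst hn
  refine ⟨Module.Basis.mkFinCons z₁ bk hli hsp, g, hg0, fun z => ?_⟩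
  set b := Module.Basis.mkFinCons z₁ bk hli hsp with hb
  have hz := b.sum_equivFun z
  have hb0 : b 0 = z₁ := by simp [hb]
  have hbs : ∀ i : Fin n, f (b i.succ) = 0 := fun i => by
    have : b i.succ = (bk i : Fin (n + 1) → ℤ) := by simp [hb]
    rw [this]
    exact (bk i).2
  rw [← hfa]
  conv_lhs => rw [← hz]
  rw [map_sum, Fin.sum_univ_succ]
  simp only [map_smul, hb0, hbs, hz₁, smul_eq_mul, mul_zero, Finset.sum_const_zero, add_zero]
  ring

lemma isLatticePoint_mulVec {k : ℕ} (U : Matrix (Fin k) (Fin k) ℤ) {x : Fin k → ℝ}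
    (hx : IsLatticePoint x) : IsLatticePoint ((U.map (Int.cast : ℤ → ℝ)).mulVec x) := by
  obtain ⟨z, rfl⟩ := hx.exists_intCast
  exact fun i => ⟨∑ j, U i j * z j, by simp [Matrix.mulVec, dotProduct]⟩

/-- Every nonzero integer linear form is an integer multiple of the first coordinate of a
unimodular transformation. -/
lemma exists_unimodular {k : ℕ} {v : Fin (k + 1) → ℤ} (hv : v ≠ 0) :
    ∃ (e : (Fin (k + 1) → ℝ) ≃ₗ[ℝ] (Fin (k + 1) → ℝ)) (g : ℤ), g ≠ 0 ∧
      (∀ x, intForm v x = g * e x 0) ∧ (∀ x, IsLatticePoint (e x) ↔ IsLatticePoint x) ∧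
      ∀ u : Fin (k + 1) → ℤ, u ≠ 0 →
        ∃ u' : Fin (k + 1) → ℤ, u' ≠ 0 ∧ ∀ x, intForm u (e x) = intForm u' x := by
  obtain ⟨b, g, hg, hb⟩ := exists_basis_coord hv
  set U := LinearMap.toMatrix' b.equivFun.toLinearMap with hU
  set V := LinearMap.toMatrix' b.equivFun.symm.toLinearMap with hV
  have hUV : U * V = 1 := by
    rw [hU, hV, ← LinearMap.toMatrix'_comp]; simp
  have hVU : V * U = 1 := by
    rw [hU, hV, ← LinearMap.toMatrix'_comp]; simp
  have hmap : ∀ {A B : Matrix (Fin (k + 1)) (Fin (k + 1)) ℤ}, A * B = 1 →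
      A.map (Int.cast : ℤ → ℝ) * B.map (Int.cast : ℤ → ℝ) = 1 := fun {A B} h => by
    change A.map (Int.castRingHom ℝ) * B.map (Int.castRingHom ℝ) = 1
    rw [← Matrix.map_mul, h]
    simp
  have hrow : ∀ i, v i = g * U 0 i := fun i => by
    have := hb (Pi.single i 1)
    rw [hU, LinearMap.toMatrix'_apply]
    simpa using this
  refine ⟨Matrix.toLin'OfInv (hmap hVU) (hmap hUV), g, hg, fun x => ?_, fun x => ⟨fun h => ?_,
    fun h => ?_⟩, fun u hu => ⟨Matrix.vecMul u U, fun h => hu ?_, fun x => ?_⟩⟩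
  · rw [intForm_apply, Matrix.toLin'OfInv_apply, Matrix.toLin'_apply]
    simp only [Matrix.mulVec, dotProduct, Matrix.map_apply, Finset.mul_sum]
    exact Finset.sum_congr rfl fun i _ => by rw [hrow]; push_cast; ring
  · have := isLatticePoint_mulVec V h
    have hx : (V.map (Int.cast : ℤ → ℝ)).mulVec
        (Matrix.toLin'OfInv (hmap hVU) (hmap hUV) x) = x := by
      have : Matrix.toLin'OfInv (hmap hVU) (hmap hUV) x
          = (U.map (Int.cast : ℤ → ℝ)).mulVec x := rfl
      rw [this, Matrix.mulVec_mulVec, hmap hVU, Matrix.one_mulVec]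
    rwa [hx] at this
  · exact isLatticePoint_mulVec U h
  · have := congrArg (fun w => Matrix.vecMul w V) h
    simpa [Matrix.vecMul_vecMul, hUV] using this
  · have : Matrix.toLin'OfInv (hmap hVU) (hmap hUV) x
        = (U.map (Int.cast : ℤ → ℝ)).mulVec x := rfl
    rw [this, intForm_apply, intForm_apply]
    have h1 : ∀ y : Fin (k + 1) → ℝ, ∑ i, (u i : ℝ) * y i = (fun i => (u i : ℝ)) ⬝ᵥ y :=
      fun _ => rfl
    rw [h1, Matrix.dotProduct_mulVec]
    refine Finset.sum_congr rfl fun i _ => ?_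
    congr 1
    simp [Matrix.vecMul, dotProduct]

/-- If a chord of a planar convex set `P` from `e` to `p` crosses a vertical line, at a point that
is far from `e`, then the vertical distance of `p` to a line through `e` is controlled by the length
of the intersection of `P` with the vertical line. -/
lemma abs_sub_line_le {P : Set (ℝ × ℝ)} (hP : Convex ℝ P) {a s j c w : ℝ} (hw : 0 < w)
    (hc : ∀ y y', (j, y) ∈ P → (j, y') ∈ P → |y - y'| ≤ c) (hj : (j, a + s * j) ∈ P)
    {e p : ℝ × ℝ} (he : e ∈ P) (hp : p ∈ P) (hel : e.2 = a + s * e.1)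
    (hje : (e.1 + w / 4 ≤ j ∧ j ≤ p.1) ∨ (p.1 ≤ j ∧ j + w / 4 ≤ e.1))
    (hpe : |p.1 - e.1| ≤ w) : |p.2 - (a + s * p.1)| ≤ 4 * c := by
  have hne : p.1 - e.1 ≠ 0 := by
    rcases hje with h | h
    · have : 0 < p.1 - e.1 := by linarith
      exact this.ne'
    · have : p.1 - e.1 < 0 := by linarith
      exact this.ne
  obtain ⟨l, hl⟩ : ∃ l, l = (j - e.1) / (p.1 - e.1) := ⟨_, rfl⟩
  have hlj : l * (p.1 - e.1) = j - e.1 := by rw [hl]; field_simp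
  have hl4 : 1 / 4 ≤ l := by
    rw [abs_le] at hpe
    rw [hl]
    rcases hje with h | h
    · rw [le_div_iff₀ (by linarith)]; linarith
    · rw [le_div_iff_of_neg (by linarith)]; linarith
  have hl1 : l ≤ 1 := by
    rw [hl]
    rcases hje with h | h
    · rw [div_le_one (by linarith)]; linarith
    · rw [div_le_one_of_neg (by linarith)]; linarith
  have hmem := hP he hp (sub_nonneg.2 hl1) (by linarith : 0 ≤ l) (by ring)
  have hpt : (1 - l) • e + l • p = (j, (1 - l) * e.2 + l * p.2) := by
    ext
    · simp only [Prod.fst_add, Prod.smul_fst, smul_eq_mul]; linarith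
    · simp
  rw [hpt] at hmem
  have h := hc _ _ hmem hj
  have heq : (1 - l) * e.2 + l * p.2 - (a + s * j) = l * (p.2 - (a + s * p.1)) := by
    have : j = e.1 + l * (p.1 - e.1) := by linarith
    rw [hel, this]; ring
  rw [heq, abs_mul, abs_of_nonneg (by linarith)] at h
  nlinarith [abs_nonneg (p.2 - (a + s * p.1))]

/-- A planar convex set with a short central vertical section lies in a narrow strip around a
line. -/
lemma exists_slope {P : Set (ℝ × ℝ)} (hP : Convex ℝ P) {α β j c : ℝ} (hw : 3 ≤ β - α)
    (hα : ∀ p ∈ P, α ≤ p.1) (hβ : ∀ p ∈ P, p.1 ≤ β)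
    (hl : ∃ p ∈ P, p.1 ≤ α + 1 / 4) (hr : ∃ p ∈ P, β - 1 / 4 ≤ p.1)
    (hj : |j - (α + β) / 2| ≤ 1 / 2) (hc : ∀ y y', (j, y) ∈ P → (j, y') ∈ P → |y - y'| ≤ c) :
    ∃ s, ∀ p ∈ P, ∀ q ∈ P, (p.2 - s * p.1) - (q.2 - s * q.1) ≤ 8 * c := by
  obtain ⟨e, he, hel⟩ := hl
  obtain ⟨f, hf, hfr⟩ := hr
  rw [abs_le] at hj
  have hef : 0 < f.1 - e.1 := by linarith
  obtain ⟨s, hs⟩ : ∃ s, s = (f.2 - e.2) / (f.1 - e.1) := ⟨_, rfl⟩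
  have hsf : s * (f.1 - e.1) = f.2 - e.2 := by rw [hs]; field_simp
  obtain ⟨a, ha⟩ : ∃ a, a = e.2 - s * e.1 := ⟨_, rfl⟩
  have hjP : (j, a + s * j) ∈ P := by
    have h0 : 0 ≤ (j - e.1) / (f.1 - e.1) := div_nonneg (by linarith) hef.le
    have h1 : (j - e.1) / (f.1 - e.1) ≤ 1 := by rw [div_le_one hef]; linarith
    have hm := hP he hf (sub_nonneg.2 h1) h0 (by ring)
    have hlj : (j - e.1) / (f.1 - e.1) * (f.1 - e.1) = j - e.1 := by field_simp
    generalize (j - e.1) / (f.1 - e.1) = l at hm hlj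
    have hpt : (1 - l) • e + l • f = (j, a + s * j) := by
      ext
      · simp only [Prod.fst_add, Prod.smul_fst, smul_eq_mul]; linarith
      · simp only [Prod.snd_add, Prod.smul_snd, smul_eq_mul]
        have : j = e.1 + l * (f.1 - e.1) := by linarith
        rw [ha, this]; linear_combination - l * hsf
    rwa [hpt] at hm
  have key : ∀ p ∈ P, |p.2 - (a + s * p.1)| ≤ 4 * c := fun p hp => by
    have h1 := hα p hp
    have h2 := hβ p hp
    have h3 := hα e he
    have h4 := hβ f hf
    rcases le_total j p.1 with h | h
    · exact abs_sub_line_le hP (w := β - α) (by linarith) hc hjP he hp (by rw [ha]; ring)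
        (Or.inl ⟨by linarith, h⟩) (by rw [abs_le]; constructor <;> linarith)
    · exact abs_sub_line_le hP (w := β - α) (by linarith) hc hjP hf hp
        (by rw [ha]; linarith) (Or.inr ⟨h, by linarith⟩)
        (by rw [abs_le]; constructor <;> linarith)
  refine ⟨s, fun p hp q hq => ?_⟩
  have h1 := abs_le.1 (key p hp)
  have h2 := abs_le.1 (key q hq)
  linarith [h1.2, h2.1]

lemma intForm_cons {k : ℕ} (n : ℤ) (v : Fin k → ℤ) (x : Fin (k + 1) → ℝ) :
    intForm (Fin.cons n v) x = n * x 0 + intForm v (Fin.tail x) := by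
  simp [intForm_apply, Fin.sum_univ_succ, Fin.tail]

lemma Convex.preimage_cons {k : ℕ} {B : Set (Fin (k + 1) → ℝ)} (hB : Convex ℝ B) (r : ℝ) :
    Convex ℝ {y : Fin k → ℝ | (Fin.cons r y : Fin (k + 1) → ℝ) ∈ B} := by
  intro y hy y' hy' a b ha hb hab
  have h : (Fin.cons r (a • y + b • y') : Fin (k + 1) → ℝ)
      = a • (Fin.cons r y : Fin (k + 1) → ℝ) + b • (Fin.cons r y' : Fin (k + 1) → ℝ) := by
    ext i
    refine Fin.cases ?_ (fun i => ?_) i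
    · simp [← add_mul, hab]
    · simp
  change (Fin.cons r (a • y + b • y') : Fin (k + 1) → ℝ) ∈ B
  rw [h]
  exact hB hy hy' ha hb hab

/-- Qualitative flatness theorem: a convex set of finite widths without lattice points is flat in
some lattice direction. -/
theorem exists_flatness_bound (k : ℕ) : ∃ c : ℝ, 0 ≤ c ∧ ∀ B : Set (Fin k → ℝ), Convex ℝ B →
    B.Nonempty → (∀ v, ∃ t, ∀ x ∈ B, ∀ y ∈ B, intForm v (x - y) ≤ t) →
    (∀ x ∈ B, ¬ IsLatticePoint x) →
    ∃ v : Fin k → ℤ, v ≠ 0 ∧ ∀ x ∈ B, ∀ y ∈ B, intForm v (x - y) ≤ c := by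
  induction k with
  | zero =>
    refine ⟨0, le_rfl, fun B _ ⟨x, hx⟩ _ hB => (hB x hx fun i => i.elim0).elim⟩
  | succ k ih =>
    obtain ⟨c, hc0, hc⟩ := ih
    refine ⟨3 + 22 * c, by positivity, fun B hBc ⟨x₀, hx₀⟩ hBb hBl => ?_⟩
    by_contra! hcon
    -- choose a lattice direction in which the width of `B` is almost minimal
    set T : Set ℝ := {t | ∃ v : Fin (k + 1) → ℤ, v ≠ 0 ∧
      ∀ x ∈ B, ∀ y ∈ B, intForm v (x - y) ≤ t} with hT
    have hTlb : ∀ t ∈ T, 3 + 22 * c ≤ t := by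
      rintro t ⟨v, hv, ht⟩
      obtain ⟨x, hx, y, hy, hxy⟩ := hcon v hv
      exact hxy.le.trans (ht x hx y hy)
    have hone : (Pi.single 0 1 : Fin (k + 1) → ℤ) ≠ 0 := by simp
    have hTne : T.Nonempty := by
      obtain ⟨t, ht⟩ := hBb (Pi.single 0 1)
      exact ⟨t, _, hone, ht⟩
    have ht0 : 3 + 22 * c ≤ sInf T := le_csInf hTne hTlb
    have hmin : ∀ t ∈ T, sInf T ≤ t := fun t ht => csInf_le ⟨_, hTlb⟩ ht
    obtain ⟨t, ⟨v, hv, hvt⟩, htlt⟩ :=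
      exists_lt_of_csInf_lt hTne (show sInf T < 5 / 4 * sInf T by linarith)
    generalize sInf T = t₀ at ht0 hmin htlt
    obtain ⟨e, g, hg, hvg, hlat, hpull⟩ := exists_unimodular hv
    have hmin' : ∀ (u : Fin (k + 1) → ℤ) (r : ℝ), u ≠ 0 →
        (∀ x ∈ B, ∀ y ∈ B, intForm u (e x) - intForm u (e y) ≤ r) → t₀ ≤ r := by
      intro u r hu h
      obtain ⟨u', hu', hue⟩ := hpull u hu
      refine hmin r ⟨u', hu', fun x hx y hy => ?_⟩
      rw [map_sub, ← hue, ← hue]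
      exact h x hx y hy
    have hle : ∀ x ∈ B, ∀ y ∈ B, e x 0 - e y 0 ≤ t := by
      intro x hx y hy
      have h1 := hvt x hx y hy
      have h2 := hvt y hy x hx
      have hg1 : (1 : ℝ) ≤ |(g : ℝ)| := by exact_mod_cast Int.one_le_abs hg
      rw [map_sub, hvg, hvg, ← mul_sub] at h1 h2
      have h3 : |(g : ℝ)| * |e x 0 - e y 0| ≤ t := by
        rw [← abs_mul, abs_le]
        exact ⟨by linarith, h1⟩
      have := le_abs_self (e x 0 - e y 0)
      nlinarith [abs_nonneg (e x 0 - e y 0)]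
    -- the range of the first coordinate
    set S : Set ℝ := (fun x => e x 0) '' B with hS
    have hSne : S.Nonempty := ⟨_, x₀, hx₀, rfl⟩
    have hSa : BddAbove S := ⟨e x₀ 0 + t, by
      rintro _ ⟨x, hx, rfl⟩; linarith [hle x hx x₀ hx₀]⟩
    have hSb : BddBelow S := ⟨e x₀ 0 - t, by
      rintro _ ⟨x, hx, rfl⟩; linarith [hle x₀ hx₀ x hx]⟩
    have hα : ∀ x ∈ B, sInf S ≤ e x 0 := fun x hx => csInf_le hSb ⟨x, hx, rfl⟩
    have hβ : ∀ x ∈ B, e x 0 ≤ sSup S := fun x hx => le_csSup hSa ⟨x, hx, rfl⟩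
    have hwt : sSup S ≤ sInf S + t := by
      refine csSup_le hSne ?_
      rintro _ ⟨x, hx, rfl⟩
      have : e x 0 - t ≤ sInf S := by
        refine le_csInf hSne ?_
        rintro _ ⟨y, hy, rfl⟩
        linarith [hle x hx y hy]
      linarith
    have hαn : ∃ x ∈ B, e x 0 ≤ sInf S + 1 / 4 := by
      obtain ⟨_, ⟨x, hx, rfl⟩, h⟩ := exists_lt_of_csInf_lt hSne
        (show sInf S < sInf S + 1 / 4 by linarith)
      exact ⟨x, hx, h.le⟩
    have hβn : ∃ x ∈ B, sSup S - 1 / 4 ≤ e x 0 := by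
      obtain ⟨_, ⟨x, hx, rfl⟩, h⟩ := exists_lt_of_lt_csSup hSne
        (show sSup S - 1 / 4 < sSup S by linarith)
      exact ⟨x, hx, h.le⟩
    generalize sInf S = α at hα hwt hαn
    generalize sSup S = β at hβ hwt hβn
    have hw0 : t₀ ≤ β - α := by
      refine hmin' (Pi.single 0 1) _ hone fun x hx y hy => ?_
      have h : ∀ z : Fin (k + 1) → ℝ, intForm (Pi.single 0 1) z = z 0 := fun z => by
        rw [intForm_apply, Finset.sum_eq_single 0] <;> simp +contextual
      rw [h, h]
      linarith [hα y hy, hβ x hx]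
    -- a central lattice slice
    obtain ⟨j, hj⟩ : ∃ j : ℤ, |(j : ℝ) - (α + β) / 2| ≤ 1 / 2 :=
      ⟨round ((α + β) / 2), by rw [abs_sub_comm]; exact abs_sub_round _⟩
    have hBe : Convex ℝ (e '' B) := hBc.linear_image e.toLinearMap
    set D : Set (Fin k → ℝ) := {y | (Fin.cons (j : ℝ) y : Fin (k + 1) → ℝ) ∈ e '' B} with hD
    have hDmem : ∀ x ∈ B, e x 0 = j → Fin.tail (e x) ∈ D := fun x hx hxj =>
      ⟨x, hx, by rw [← hxj, Fin.cons_self_tail]⟩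
    have hDne : D.Nonempty := by
      have hSc : Convex ℝ S := by
        have := hBe.linear_image (LinearMap.proj (R := ℝ) (φ := fun _ => ℝ) (0 : Fin (k + 1)))
        rwa [Set.image_image] at this
      obtain ⟨x, hx, hxα⟩ := hαn
      obtain ⟨y, hy, hyβ⟩ := hβn
      rw [abs_le] at hj
      obtain ⟨z, hz, hzj⟩ := hSc.ordConnected.out ⟨x, hx, rfl⟩ ⟨y, hy, rfl⟩
        (show (j : ℝ) ∈ Set.Icc (e x 0) (e y 0) from ⟨by linarith, by linarith⟩)
      exact ⟨_, hDmem z hz hzj⟩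
    have hDb : ∀ u, ∃ r, ∀ x ∈ D, ∀ y ∈ D, intForm u (x - y) ≤ r := by
      intro u
      rcases eq_or_ne u 0 with rfl | hu
      · exact ⟨0, fun x _ y _ => by simp [intForm_apply]⟩
      · obtain ⟨u', -, hue⟩ := hpull (Fin.cons 0 u) (fun h => hu (by
          ext i; simpa using congrFun h i.succ))
        obtain ⟨r, hr⟩ := hBb u'
        refine ⟨r, ?_⟩
        rintro x ⟨x', hx', hxe⟩ y ⟨y', hy', hye⟩
        have := hr x' hx' y' hy'
        rw [map_sub, ← hue, ← hue, hxe, hye, intForm_cons, intForm_cons] at this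
        simpa using this
    have hDl : ∀ x ∈ D, ¬ IsLatticePoint x := by
      rintro x ⟨x', hx', hxe⟩ hx
      refine hBl x' hx' ((hlat x').1 ?_)
      rw [hxe]
      exact fun i => Fin.cases ⟨j, rfl⟩ hx i
    obtain ⟨u, hu, huc⟩ := hc D (hBe.preimage_cons _) hDne hDb hDl
    -- project to the plane
    set F : (Fin (k + 1) → ℝ) →ₗ[ℝ] ℝ × ℝ :=
      ((LinearMap.proj 0).prod (intForm (Fin.cons 0 u))).comp e.toLinearMap with hF
    have hF1 : ∀ x, (F x).1 = e x 0 := fun x => rfl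
    have hF2 : ∀ x, (F x).2 = intForm u (Fin.tail (e x)) := fun x => by
      have : (F x).2 = intForm (Fin.cons 0 u) (e x) := rfl
      rw [this, intForm_cons]; simp
    obtain ⟨s, hs⟩ := exists_slope (hBc.linear_image F) (α := α) (β := β) (j := j) (c := c)
      (by linarith) (by rintro _ ⟨x, hx, rfl⟩; exact hα x hx)
      (by rintro _ ⟨x, hx, rfl⟩; exact hβ x hx)
      (by obtain ⟨x, hx, h⟩ := hαn; exact ⟨_, ⟨x, hx, rfl⟩, h⟩)
      (by obtain ⟨x, hx, h⟩ := hβn; exact ⟨_, ⟨x, hx, rfl⟩, h⟩) hj (by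
        rintro y y' ⟨x, hx, hxy⟩ ⟨x', hx', hxy'⟩
        have h1 := hDmem x hx (by rw [← hF1, hxy])
        have h2 := hDmem x' hx' (by rw [← hF1, hxy'])
        have h3 := huc _ h1 _ h2
        have h4 := huc _ h2 _ h1
        rw [map_sub, ← hF2, ← hF2, hxy, hxy'] at h3 h4
        rw [abs_le]
        constructor <;> simp only at h3 h4 <;> linarith)
    have hfin : t₀ ≤ 8 * c + (β - α) / 2 := by
      refine hmin' (Fin.cons (-round s) u) _ (fun h => hu (by
          ext i; simpa using congrFun h i.succ)) fun x hx y hy => ?_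
      have h := hs _ ⟨x, hx, rfl⟩ _ ⟨y, hy, rfl⟩
      rw [hF1, hF1, hF2, hF2] at h
      rw [intForm_cons, intForm_cons]
      push_cast
      have h1 : |(s - round s) * (e x 0 - e y 0)| ≤ 1 / 2 * (β - α) := by
        rw [abs_mul]
        refine mul_le_mul (abs_sub_round s) ?_ (abs_nonneg _) (by norm_num)
        rw [abs_le]
        constructor <;> linarith [hα x hx, hα y hy, hβ x hx, hβ y hy]
      have h2 := (abs_le.1 h1).2
      linarith
    linarith

lemma latticeWidth_le {k : ℕ} {B : Set (Fin k → ℝ)} {c : ℝ} {v : Fin k → ℤ} (hv : v ≠ 0)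
    (h : ∀ x ∈ B, ∀ y ∈ B, intForm v (x - y) ≤ c) : latticeWidth B ≤ ENNReal.ofReal c := by
  refine (iInf₂_le v hv).trans (iSup₂_le fun x hx => iSup₂_le fun y hy => ?_)
  have := h x hx y hy
  rw [intForm_apply] at this
  exact ENNReal.ofReal_le_ofReal this

lemma le_latticeWidth {k : ℕ} {B : Set (Fin k → ℝ)} {c : ℝ}
    (h : ∀ v : Fin k → ℤ, v ≠ 0 → ∃ x ∈ B, ∃ y ∈ B, c ≤ intForm v (x - y)) :
    ENNReal.ofReal c ≤ latticeWidth B := by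
  refine le_iInf₂ fun v hv => ?_
  obtain ⟨x, hx, y, hy, hxy⟩ := h v hv
  rw [intForm_apply] at hxy
  exact (ENNReal.ofReal_le_ofReal hxy).trans
    (le_iSup₂_of_le x hx (le_iSup₂_of_le y hy le_rfl))

lemma Bornology.IsBounded.exists_intForm_le {k : ℕ} {B : Set (Fin k → ℝ)}
    (hB : Bornology.IsBounded B) (v : Fin k → ℤ) :
    ∃ t, ∀ x ∈ B, ∀ y ∈ B, intForm v (x - y) ≤ t := by
  obtain ⟨R, hR⟩ := hB.exists_norm_le
  refine ⟨∑ i, |(v i : ℝ)| * (R + R), fun x hx y hy => ?_⟩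
  rw [intForm_apply]
  refine Finset.sum_le_sum fun i _ => ?_
  have h : |(x - y) i| ≤ R + R :=
    (norm_le_pi_norm (x - y) i).trans ((norm_sub_le x y).trans (add_le_add (hR x hx) (hR y hy)))
  calc (v i : ℝ) * (x - y) i ≤ |(v i : ℝ) * (x - y) i| := le_abs_self _
    _ = |(v i : ℝ)| * |(x - y) i| := abs_mul _ _
    _ ≤ _ := mul_le_mul_of_nonneg_left h (abs_nonneg _)

lemma intForm_single {k : ℕ} (v : Fin k → ℤ) (i : Fin k) (r : ℝ) :
    intForm v (Pi.single i r) = v i * r := by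
  rw [intForm_apply, Finset.sum_eq_single i] <;> simp +contextual

/-- A full-dimensional convex set all of whose lattice widths exceed `c` has a bounded convex subset
with the same property. -/
lemma exists_isBounded_subset {k : ℕ} {B : Set (Fin k → ℝ)} (hB : Convex ℝ B)
    (hspan : affineSpan ℝ B = ⊤) {c : ℝ}
    (h : ∀ v : Fin k → ℤ, v ≠ 0 → ∃ x ∈ B, ∃ y ∈ B, c < intForm v (x - y)) :
    ∃ B' ⊆ B, Convex ℝ B' ∧ B'.Nonempty ∧ Bornology.IsBounded B' ∧
      ∀ v : Fin k → ℤ, v ≠ 0 → ∃ x ∈ B', ∃ y ∈ B', c < intForm v (x - y) := by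
  obtain ⟨x₀, hx₀⟩ := hB.interior_nonempty_iff_affineSpan_eq_top.2 hspan
  obtain ⟨r, hr, hball⟩ := Metric.nhds_basis_closedBall.mem_iff.1 (mem_interior_iff_mem_nhds.1 hx₀)
  choose! f hf g hg hfg using h
  set W : Set (Fin k → ℤ) := Set.pi Set.univ fun _ => {n : ℤ | |(n : ℝ)| ≤ c / r} with hW
  have hWfin : W.Finite := by
    refine Set.Finite.pi (ι := Fin k) fun _ =>
      (Set.finite_Icc (-⌈c / r⌉) ⌈c / r⌉).subset fun n hn => ?_
    have h1 := abs_le.1 (show |(n : ℝ)| ≤ c / r from hn)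
    have h2 := Int.le_ceil (c / r)
    constructor
    · have : (-⌈c / r⌉ : ℝ) ≤ n := by linarith
      exact_mod_cast this
    · have : (n : ℝ) ≤ ⌈c / r⌉ := by linarith
      exact_mod_cast this
  set W' : Set (Fin k → ℤ) := W \ {0} with hW'
  set G : Set (Fin k → ℝ) := Metric.closedBall x₀ r ∪ (f '' W' ∪ g '' W') with hG
  have hGB : G ⊆ B := by
    refine Set.union_subset hball (Set.union_subset ?_ ?_)
    · rintro _ ⟨v, hv, rfl⟩; exact hf v hv.2
    · rintro _ ⟨v, hv, rfl⟩; exact hg v hv.2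
  have hsub := subset_convexHull ℝ G
  have hx₀G : x₀ ∈ G := Or.inl (Metric.mem_closedBall_self hr.le)
  refine ⟨convexHull ℝ G, convexHull_min hGB hB, convex_convexHull ℝ G, ⟨x₀, hsub hx₀G⟩,
    isBounded_convexHull.2 ?_, fun v hv => ?_⟩
  · have hfin := hWfin.subset (Set.sdiff_subset (t := {0}))
    exact Metric.isBounded_closedBall.union
      ((hfin.image f).isBounded.union (hfin.image g).isBounded)
  · by_cases hvW : v ∈ W
    · exact ⟨f v, hsub (Or.inr (Or.inl ⟨v, ⟨hvW, hv⟩, rfl⟩)), g v,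
        hsub (Or.inr (Or.inr ⟨v, ⟨hvW, hv⟩, rfl⟩)), hfg v hv⟩
    · obtain ⟨i, hi⟩ : ∃ i, c / r < |(v i : ℝ)| := by
        simpa [hW] using hvW
      rw [div_lt_iff₀ hr] at hi
      have hmem : x₀ + Pi.single i r ∈ G := Or.inl (by
        rw [mem_closedBall_iff_norm, add_sub_cancel_left, pi_norm_le_iff_of_nonneg hr.le]
        intro l
        rcases eq_or_ne l i with rfl | hl
        · simp [abs_of_pos hr]
        · simp [hl, hr.le])
      have hd : intForm v (x₀ + Pi.single i r - x₀) = v i * r := by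
        rw [add_sub_cancel_left, intForm_single]
      have hd' : intForm v (x₀ - (x₀ + Pi.single i r)) = -(v i * r) := by
        rw [sub_add_cancel_left, map_neg, intForm_single]
      rcases le_total 0 (v i : ℝ) with h0 | h0
      · refine ⟨_, hsub hmem, _, hsub hx₀G, ?_⟩
        rwa [hd, ← abs_of_nonneg h0]
      · refine ⟨_, hsub hx₀G, _, hsub hmem, ?_⟩
        rwa [hd', ← neg_mul, ← abs_of_nonpos h0]

theorem flatnessConst_ne_top (k : ℕ) : flatnessConst k ≠ ⊤ := by
  obtain ⟨c, hc0, hc⟩ := exists_flatness_bound k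
  refine ne_top_of_le_ne_top (ENNReal.ofReal_ne_top (r := c)) (iSup₂_le ?_)
  rintro B ⟨hB, -, hspan, hBl⟩
  by_contra hcon
  obtain ⟨B', hB'B, hB'c, hB'n, hB'b, hB'w⟩ := exists_isBounded_subset hB hspan (c := c) (by
    intro v hv
    by_contra! h
    exact hcon (latticeWidth_le hv h))
  obtain ⟨v, hv, hvc⟩ := hc B' hB'c hB'n hB'b.exists_intForm_le fun x hx => hBl x (hB'B hx)
  obtain ⟨x, hx, y, hy, hxy⟩ := hB'w v hv
  exact (hvc x hx y hy).not_gt hxy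

lemma latticeWidth_le_latticeWidth_tail {k : ℕ} {B : Set (Fin k → ℝ)} (hB : B.Nonempty) :
    latticeWidth B ≤ latticeWidth {x : Fin (k + 1) → ℝ | Fin.tail x ∈ B} := by
  refine le_iInf₂ fun v hv => ?_
  obtain ⟨y, hy⟩ := hB
  by_cases h0 : v 0 = 0
  · have ht : Fin.tail v ≠ 0 := fun h => hv (by
      ext i
      refine Fin.cases h0 (fun i => ?_) i
      exact congrFun h i)
    refine (iInf₂_le (Fin.tail v : Fin k → ℤ) ht).trans
      (iSup₂_le fun x hx => iSup₂_le fun y hy => ?_)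
    refine le_iSup₂_of_le (Fin.cons 0 x : Fin (k + 1) → ℝ) hx
      (le_iSup₂_of_le (Fin.cons 0 y : Fin (k + 1) → ℝ) hy ?_)
    simp [Fin.sum_univ_succ, Fin.tail]
  · refine le_of_le_of_eq le_top (ENNReal.eq_top_of_forall_nnreal_le fun r => ?_).symm
    have h0' : (v 0 : ℝ) ≠ 0 := by exact_mod_cast h0
    refine le_iSup₂_of_le (Fin.cons (r / v 0 : ℝ) y : Fin (k + 1) → ℝ) hy
      (le_iSup₂_of_le (Fin.cons 0 y : Fin (k + 1) → ℝ) hy ?_)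
    simp [Fin.sum_univ_succ, mul_div_cancel₀ _ h0']

lemma flatnessConst_le_succ (k : ℕ) : flatnessConst k ≤ flatnessConst (k + 1) := by
  refine iSup₂_le ?_
  rintro B ⟨hB, hcl, hspan, hBl⟩
  obtain ⟨x₀, hx₀⟩ := hB.interior_nonempty_iff_affineSpan_eq_top.2 hspan
  have htail : Continuous (Fin.tail : (Fin (k + 1) → ℝ) → Fin k → ℝ) := by
    unfold Fin.tail; fun_prop
  have hconv : Convex ℝ {x : Fin (k + 1) → ℝ | Fin.tail x ∈ B} :=
    hB.linear_preimage (LinearMap.funLeft ℝ ℝ Fin.succ)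
  refine (latticeWidth_le_latticeWidth_tail ⟨x₀, interior_subset hx₀⟩).trans
    (le_iSup₂_of_le {x : Fin (k + 1) → ℝ | Fin.tail x ∈ B}
      ⟨hconv, hcl.preimage htail, ?_, fun x hx hxl => hBl _ hx fun i => hxl i.succ⟩ le_rfl)
  refine hconv.interior_nonempty_iff_affineSpan_eq_top.1 ⟨Fin.cons 0 x₀, ?_⟩
  refine interior_maximal (s := {x : Fin (k + 1) → ℝ | Fin.tail x ∈ B})
    (t := Fin.tail ⁻¹' interior B) (fun x hx => interior_subset (s := B) hx)
    (isOpen_interior.preimage htail) ?_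
  simpa using hx₀

/-- The flatness constant also applies to convex sets that are not closed. -/
lemma exists_isLatticePoint_of_flatnessConst_lt {k : ℕ} {B : Set (Fin k → ℝ)} (hB : Convex ℝ B)
    (hspan : affineSpan ℝ B = ⊤) {c : ℝ} (hc : flatnessConst k < ENNReal.ofReal c)
    (h : ∀ v : Fin k → ℤ, v ≠ 0 → ∃ x ∈ B, ∃ y ∈ B, c ≤ intForm v (x - y)) :
    ∃ x ∈ B, IsLatticePoint x := by
  by_contra! hBl
  obtain ⟨x₀, hx₀⟩ := hB.interior_nonempty_iff_affineSpan_eq_top.2 hspan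
  have hc' := (ENNReal.lt_ofReal_iff_toReal_lt (ne_top_of_lt hc)).1 hc
  have hcpos : 0 < c := ENNReal.toReal_nonneg.trans_lt hc'
  obtain ⟨q, hq1, hqc⟩ : ∃ q : ℝ, (flatnessConst k).toReal < q ∧ q < c := exists_between hc'
  have hq0 : 0 < q := ENNReal.toReal_nonneg.trans_lt hq1
  set s := q / c with hs
  have hs0 : 0 < s := div_pos hq0 hcpos
  have hs1 : 1 < s⁻¹ := by rw [hs, inv_div, one_lt_div hq0]; exact hqc
  have hsc : s * c = q := by rw [hs]; field_simp
  set A : Set (Fin k → ℝ) := AffineMap.homothety x₀ s⁻¹ ⁻¹' closure B with hA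
  have hcont : Continuous (AffineMap.homothety x₀ s⁻¹ : (Fin k → ℝ) → Fin k → ℝ) :=
    AffineMap.homothety_continuous x₀ s⁻¹
  have hinv : ∀ x : Fin k → ℝ, AffineMap.homothety x₀ s⁻¹ (AffineMap.homothety x₀ s x) = x := by
    intro x
    rw [← AffineMap.homothety_mul_apply, inv_mul_cancel₀ hs0.ne']
    simp
  have hinv' : ∀ x : Fin k → ℝ, AffineMap.homothety x₀ s (AffineMap.homothety x₀ s⁻¹ x) = x := by
    intro x
    rw [← AffineMap.homothety_mul_apply, mul_inv_cancel₀ hs0.ne']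
    simp
  have hAconv : Convex ℝ A := hB.closure.affine_preimage _
  have hAB : A ⊆ B := by
    intro x hx
    obtain ⟨y, hy, hyx⟩ := hB.closure_subset_image_homothety_interior_of_one_lt hx₀ s⁻¹ hs1 hx
    have := congrArg (AffineMap.homothety x₀ s) hyx
    rw [hinv', hinv'] at this
    rw [← this]
    exact interior_subset hy
  have hAmem : A ∈ {A : Set (Fin k → ℝ) | Convex ℝ A ∧ IsClosed A ∧ affineSpan ℝ A = ⊤ ∧
      ∀ x ∈ A, ¬ IsLatticePoint x} := by
    refine ⟨hAconv, isClosed_closure.preimage hcont, ?_, fun x hx => hBl x (hAB hx)⟩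
    refine hAconv.interior_nonempty_iff_affineSpan_eq_top.1 ⟨x₀, ?_⟩
    refine interior_maximal (s := A) (t := AffineMap.homothety x₀ s⁻¹ ⁻¹' interior B)
      (fun x hx => subset_closure (interior_subset (s := B) hx))
      (isOpen_interior.preimage hcont) ?_
    simpa using hx₀
  have hle : ENNReal.ofReal q ≤ flatnessConst k := by
    refine le_trans (le_latticeWidth fun v hv => ?_) (le_iSup₂_of_le A hAmem le_rfl)
    obtain ⟨x, hx, y, hy, hxy⟩ := h v hv
    refine ⟨AffineMap.homothety x₀ s x, ?_, AffineMap.homothety x₀ s y, ?_, ?_⟩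
    · rw [hA, Set.mem_preimage, hinv]; exact subset_closure hx
    · rw [hA, Set.mem_preimage, hinv]; exact subset_closure hy
    · have : AffineMap.homothety x₀ s x - AffineMap.homothety x₀ s y = s • (x - y) := by
        simp only [AffineMap.homothety_apply, vsub_eq_sub, vadd_eq_add]
        module
      rw [this, map_smul, smul_eq_mul, ← hsc]
      exact mul_le_mul_of_nonneg_left hxy hs0.le
  exact ((ENNReal.ofReal_le_iff_le_toReal (ne_top_of_lt hc)).1 hle).not_gt hq1

/-- A set of lattice points that does not affinely span the space has width zero in some lattice
direction. -/
lemma exists_intForm_sub_eq_zero {k : ℕ} {Z : Set (Fin k → ℝ)} (hZ : Z.Nonempty)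
    (hl : ∀ x ∈ Z, IsLatticePoint x) (hspan : affineSpan ℝ Z ≠ ⊤) :
    ∃ v : Fin k → ℤ, v ≠ 0 ∧ ∀ x ∈ Z, ∀ y ∈ Z, intForm v (x - y) = 0 := by
  rw [Ne, AffineSubspace.affineSpan_eq_top_iff_vectorSpan_eq_top_of_nonempty ℝ _ _ hZ] at hspan
  obtain ⟨f, hf0, hf⟩ := Submodule.exists_le_ker_of_lt_top _ (lt_top_iff_ne_top.2 hspan)
  have hfx : ∀ x : Fin k → ℝ, f x = ∑ i, x i * f (Pi.single i 1) := fun x => by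
    conv_lhs => rw [pi_eq_sum_univ' x, map_sum]
    refine Finset.sum_congr rfl fun i _ => ?_
    rw [map_smul, smul_eq_mul]
  obtain ⟨i, hi⟩ : ∃ i, f (Pi.single i 1) ≠ 0 := by
    by_contra! h
    exact hf0 (LinearMap.ext fun x => by rw [hfx]; simp [h])
  obtain ⟨φ, hφ⟩ : ∃ φ : Module.Dual ℚ ℝ, φ (f (Pi.single i 1)) ≠ 0 := by
    by_contra! h
    exact hi ((Module.forall_dual_apply_eq_zero_iff ℚ _).1 h)
  obtain ⟨b, hb⟩ := IsLocalization.exist_integer_multiples (nonZeroDivisors ℤ)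
    (Finset.univ : Finset (Fin k)) fun j => φ (f (Pi.single j 1))
  choose v hv using fun j => hb j (Finset.mem_univ j)
  have hv' : ∀ j, (v j : ℚ) = (b : ℤ) * φ (f (Pi.single j 1)) := fun j => by
    simpa using hv j
  have hb0 : ((b : ℤ) : ℚ) ≠ 0 := by exact_mod_cast nonZeroDivisors.coe_ne_zero b
  refine ⟨v, fun h => ?_, fun x hx y hy => ?_⟩
  · have := hv' i
    rw [h] at this
    simp only [Pi.zero_apply, Int.cast_zero] at this
    exact mul_ne_zero hb0 hφ this.symm
  · obtain ⟨p, rfl⟩ := (hl x hx).exists_intCast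
    obtain ⟨q, rfl⟩ := (hl y hy).exists_intCast
    have h0 := hf (vsub_mem_vectorSpan ℝ hx hy)
    rw [LinearMap.mem_ker, hfx] at h0
    have h1 : ∑ j, ((p j - q j : ℤ) : ℚ) * φ (f (Pi.single j 1)) = 0 := by
      have h2 := congrArg φ h0
      rw [map_sum, map_zero] at h2
      rw [← h2]
      refine Finset.sum_congr rfl fun j _ => ?_
      rw [← smul_eq_mul, ← map_smul]
      congr 1
      rw [Rat.smul_def]
      simp
    have h3 : ∑ j, v j * (p j - q j) = 0 := by
      have : ∑ j, (v j : ℚ) * (p j - q j) = 0 := by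
        calc ∑ j, (v j : ℚ) * (p j - q j)
            = b * ∑ j, ((p j - q j : ℤ) : ℚ) * φ (f (Pi.single j 1)) := by
              rw [Finset.mul_sum]
              refine Finset.sum_congr rfl fun j _ => ?_
              rw [hv']; push_cast; ring
          _ = 0 := by rw [h1, mul_zero]
      exact_mod_cast this
    rw [intForm_apply]
    have := congrArg (Int.cast : ℤ → ℝ) h3
    push_cast at this
    simpa using this

lemma IsPolyhedronOfSize.convex {ι : Type*} {Q : Set (ι → ℝ)} {m : ℕ}
    (hQ : IsPolyhedronOfSize Q m) : Convex ℝ Q := by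
  obtain ⟨S, n, -, f, b, rfl⟩ := hQ
  refine S.convex.inter ?_
  rw [Set.ofPred_forall]
  exact convex_iInter fun i => convex_halfSpace_le (f i).isLinear (b i)

lemma IsPolyhedronOfSize.inter_affineSubspace {ι : Type*} {Q : Set (ι → ℝ)} {m : ℕ}
    (hQ : IsPolyhedronOfSize Q m) (S : AffineSubspace ℝ (ι → ℝ)) :
    IsPolyhedronOfSize (Q ∩ S) m := by
  obtain ⟨S', n, hn, f, b, rfl⟩ := hQ
  exact ⟨S' ⊓ S, n, hn, f, b, Set.inter_right_comm _ _ _⟩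

/-- Every linear form exceeds its bounds on `A` by at most a factor `δ` on `R`. -/
def Approximates {E : Type*} [AddCommGroup E] [Module ℝ E] (δ : ℝ) (A R : Set E) : Prop :=
  ∀ (φ : E →ₗ[ℝ] ℝ) (lo hi : ℝ), (∀ a ∈ A, lo ≤ φ a ∧ φ a ≤ hi) →
    ∀ b ∈ R, φ b ≤ hi + δ * (hi - lo)

lemma Approximates.mono {E : Type*} [AddCommGroup E] [Module ℝ E] {δ : ℝ} {A A' R : Set E}
    (h : Approximates δ A R) (hA : A ⊆ A') : Approximates δ A' R :=
  fun φ lo hi hb => h φ lo hi fun a ha => hb a (hA ha)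

lemma Approximates.refl {E : Type*} [AddCommGroup E] [Module ℝ E] {δ : ℝ} (hδ : 0 ≤ δ)
    (A : Set E) : Approximates δ A A := fun φ lo hi h b hb => by
  have := h b hb
  have := mul_nonneg hδ (show 0 ≤ hi - lo by linarith)
  linarith

/-- If the mixed-integer points of `Q` are wide in every lattice direction, then they approximate
`Q`. -/
lemma approximates_of_wide {l k : ℕ} {δ F : ℝ} (hδ : 0 < δ)
    (hF : (1 + δ) / δ * (flatnessConst k).toReal ≤ F) {Q : Set (Fin l → ℝ)} (hQ : Convex ℝ Q)
    (σ : (Fin l → ℝ) →ᵃ[ℝ] (Fin k → ℝ)) (hne : (Q ∩ {x | IsLatticePoint (σ x)}).Nonempty)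
    (hwide : ∀ v : Fin k → ℤ, v ≠ 0 → ∃ x ∈ Q ∩ {x | IsLatticePoint (σ x)},
      ∃ y ∈ Q ∩ {x | IsLatticePoint (σ x)}, F < intForm v (σ x - σ y)) :
    Approximates δ (Q ∩ {x | IsLatticePoint (σ x)}) Q := by
  intro φ lo hi hφ b hb
  set A := Q ∩ {x | IsLatticePoint (σ x)} with hA
  set t := δ / (1 + δ) with ht
  have hδ1 : 0 < 1 + δ := by linarith
  have ht0 : 0 < t := div_pos hδ hδ1
  have ht1 : t * (1 + δ) = δ := by rw [ht]; field_simp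
  have hF0 : 0 ≤ F := le_trans (mul_nonneg (div_nonneg hδ1.le hδ.le) ENNReal.toReal_nonneg) hF
  have hAQ : convexHull ℝ A ⊆ Q := convexHull_min Set.inter_subset_left hQ
  -- the shrunken copy of `σ (conv A)` towards `σ b`
  set K := AffineMap.homothety (σ b) t '' (σ '' convexHull ℝ A) with hK
  have hσK : σ '' convexHull ℝ A = convexHull ℝ (σ '' A) := σ.image_convexHull A
  have hspanA : affineSpan ℝ (σ '' A) = ⊤ := by
    by_contra hcon
    obtain ⟨v, hv, hv0⟩ := exists_intForm_sub_eq_zero (hne.image σ)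
      (by rintro _ ⟨x, hx, rfl⟩; exact hx.2) hcon
    obtain ⟨x, hx, y, hy, hxy⟩ := hwide v hv
    rw [hv0 _ ⟨x, hx, rfl⟩ _ ⟨y, hy, rfl⟩] at hxy
    exact hxy.not_ge hF0
  have hspanK : affineSpan ℝ K = ⊤ := by
    rw [hK, hσK]
    refine AffineMap.span_eq_top_of_surjective _ (fun x =>
      ⟨AffineMap.homothety (σ b) t⁻¹ x, ?_⟩) (by rw [affineSpan_convexHull, hspanA])
    rw [← AffineMap.homothety_mul_apply, mul_inv_cancel₀ ht0.ne']
    simp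
  have hKconv : Convex ℝ K := ((convex_convexHull ℝ A).affine_image σ).affine_image _
  obtain ⟨_, ⟨_, ⟨x, hx, rfl⟩, rfl⟩, hxl⟩ := exists_isLatticePoint_of_flatnessConst_lt hKconv hspanK
    (c := t * (⌊F⌋ + 1)) (by
      rw [ENNReal.lt_ofReal_iff_toReal_lt (flatnessConst_ne_top k)]
      have h1 : t * ((1 + δ) / δ * (flatnessConst k).toReal) = (flatnessConst k).toReal := by
        rw [ht]; field_simp
      rw [← h1]
      exact mul_lt_mul_of_pos_left (hF.trans_lt (Int.lt_floor_add_one F)) ht0) (by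
      intro v hv
      obtain ⟨x, hx, y, hy, hxy⟩ := hwide v hv
      refine ⟨_, ⟨_, ⟨x, subset_convexHull ℝ A hx, rfl⟩, rfl⟩,
        _, ⟨_, ⟨y, subset_convexHull ℝ A hy, rfl⟩, rfl⟩, ?_⟩
      have : AffineMap.homothety (σ b) t (σ x) - AffineMap.homothety (σ b) t (σ y)
          = t • (σ x - σ y) := by
        simp only [AffineMap.homothety_apply, vsub_eq_sub, vadd_eq_add]
        module
      rw [this, map_smul, smul_eq_mul]
      refine mul_le_mul_of_nonneg_left ?_ ht0.le
      obtain ⟨n, hn⟩ := hx.2.exists_intForm_eq v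
      obtain ⟨n', hn'⟩ := hy.2.exists_intForm_eq v
      rw [map_sub, hn, hn'] at hxy ⊢
      have h2 : F < ((n - n' : ℤ) : ℝ) := by exact_mod_cast hxy
      exact_mod_cast Int.add_one_le_of_lt (Int.floor_lt.2 h2))
  have hp : AffineMap.homothety b t x ∈ A := by
    refine ⟨?_, ?_⟩
    · have := hQ hb (hAQ hx) (show 0 ≤ 1 - t by nlinarith) ht0.le (by ring)
      rw [AffineMap.homothety_apply, vsub_eq_sub, vadd_eq_add]
      convert this using 1
      module
    · have : σ (AffineMap.homothety b t x) = AffineMap.homothety (σ b) t (σ x) := by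
        rw [AffineMap.homothety_eq_lineMap, AffineMap.homothety_eq_lineMap, AffineMap.apply_lineMap]
      change IsLatticePoint _
      rwa [this]
  have hlo : lo ≤ φ x := by
    have : convexHull ℝ A ⊆ {x | lo ≤ φ x} :=
      convexHull_min (fun a ha => (hφ a ha).1) (convex_halfSpace_ge φ.isLinear lo)
    exact this hx
  have hhi := (hφ _ hp).2
  rw [AffineMap.homothety_apply, vsub_eq_sub, vadd_eq_add, map_add, map_smul, map_sub,
    smul_eq_mul] at hhi
  have h3 := mul_le_mul_of_nonneg_left hhi hδ1.le
  have h4 : (1 + δ) * (t * (φ x - φ b) + φ b) = δ * (φ x - φ b) + (1 + δ) * φ b := by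
    linear_combination (φ x - φ b) * ht1
  have h5 := mul_le_mul_of_nonneg_left hlo hδ.le
  linarith

lemma card_le_of_forall_sub_le {J : Set ℤ} {F : ℝ} (hF : 0 ≤ F)
    (h : ∀ i ∈ J, ∀ j ∈ J, ((i - j : ℤ) : ℝ) ≤ F) :
    ∃ s : Finset ℤ, ↑s = J ∧ (s.card : ℝ) ≤ 1 + F := by
  rcases J.eq_empty_or_nonempty with rfl | ⟨i₀, hi₀⟩
  · exact ⟨∅, by simp, by simp; linarith⟩
  have hb : BddBelow J := ⟨i₀ - ⌊F⌋, fun j hj => by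
    have := Int.le_floor.2 (h i₀ hi₀ j hj)
    linarith⟩
  obtain ⟨a, ha, hmin⟩ : ∃ a ∈ J, ∀ j ∈ J, a ≤ j :=
    ⟨sInf J, Int.csInf_mem ⟨i₀, hi₀⟩ hb, fun j hj => csInf_le hb hj⟩
  have hsub : J ⊆ Finset.Icc a (a + ⌊F⌋) := fun j hj => by
    have := Int.le_floor.2 (h j hj a ha)
    rw [Finset.coe_Icc]
    exact ⟨hmin j hj, by linarith⟩
  have hfin : J.Finite := (Finset.finite_toSet _).subset hsub
  refine ⟨hfin.toFinset, hfin.coe_toFinset, ?_⟩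
  have h1 : hfin.toFinset.card ≤ (Finset.Icc a (a + ⌊F⌋)).card :=
    Finset.card_le_card fun j hj => by
      have := hsub (hfin.mem_toFinset.1 hj)
      exact_mod_cast this
  rw [Int.card_Icc] at h1
  have h2 : ((a + ⌊F⌋ + 1 - a).toNat : ℤ) = 1 + ⌊F⌋ := by
    rw [Int.toNat_of_nonneg (by linarith [Int.floor_nonneg.2 hF])]
    ring
  have h3 : (hfin.toFinset.card : ℤ) ≤ 1 + ⌊F⌋ := by rw [← h2]; exact_mod_cast h1
  have h4 : (hfin.toFinset.card : ℝ) ≤ 1 + ⌊F⌋ := by exact_mod_cast h3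
  linarith [Int.floor_le F]

/-- The mixed-integer points of a polyhedron can be covered by few slices of the polyhedron that are
well approximated by mixed-integer points. -/
theorem exists_slices {l m : ℕ} {δ F : ℝ} (hδ : 0 < δ) (k : ℕ)
    (hF : (1 + δ) / δ * (flatnessConst k).toReal ≤ F) (Q : Set (Fin l → ℝ))
    (hQ : IsPolyhedronOfSize Q m) (σ : (Fin l → ℝ) →ᵃ[ℝ] (Fin k → ℝ)) :
    ∃ 𝓡 : Finset (Set (Fin l → ℝ)),
      (∀ R ∈ 𝓡, IsPolyhedronOfSize R m ∧
        Approximates δ (Q ∩ {x | IsLatticePoint (σ x)}) R) ∧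
      (∀ x ∈ Q ∩ {x | IsLatticePoint (σ x)}, ∃ R ∈ 𝓡, x ∈ R) ∧
      (𝓡.card : ℝ) ≤ (1 + F) ^ k := by
  classical
  have hF0 : 0 ≤ F :=
    le_trans (mul_nonneg (div_nonneg (by linarith) hδ.le) ENNReal.toReal_nonneg) hF
  induction k generalizing Q with
  | zero =>
    refine ⟨{Q}, fun R hR => ?_, fun x hx => ⟨Q, by simp, hx.1⟩, by simp⟩
    obtain rfl := Finset.mem_singleton.1 hR
    refine ⟨hQ, (Approximates.refl hδ.le R).mono fun x hx => ⟨hx, fun i => i.elim0⟩⟩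
  | succ k ih =>
    set A := Q ∩ {x | IsLatticePoint (σ x)} with hA
    rcases A.eq_empty_or_nonempty with hAe | hAne
    · exact ⟨∅, by simp, by simp [hAe], by simp; positivity⟩
    by_cases hwide : ∀ v : Fin (k + 1) → ℤ, v ≠ 0 → ∃ x ∈ A, ∃ y ∈ A, F < intForm v (σ x - σ y)
    · refine ⟨{Q}, fun R hR => ?_, fun x hx => ⟨Q, by simp, hx.1⟩, ?_⟩
      · obtain rfl := Finset.mem_singleton.1 hR
        exact ⟨hQ, approximates_of_wide hδ hF hQ.convex σ hAne hwide⟩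
      · simpa using one_le_pow₀ (by linarith : 1 ≤ 1 + F)
    push Not at hwide
    obtain ⟨v, hv, hvF⟩ := hwide
    obtain ⟨e, g, hg, hvg, hlat, -⟩ := exists_unimodular hv
    have hcoord : ∀ x ∈ A, ∃ n : ℤ, e (σ x) 0 = n := fun x hx => (hlat _).2 hx.2 0
    obtain ⟨s, hsJ, hs⟩ := card_le_of_forall_sub_le (J := {n | ∃ x ∈ A, e (σ x) 0 = n}) hF0 (by
      rintro i ⟨x, hx, hxi⟩ j ⟨y, hy, hyj⟩
      have h1 := hvF x hx y hy
      have h2 := hvF y hy x hx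
      rw [map_sub, hvg, hvg, ← mul_sub, hxi, hyj] at h1 h2
      have hg1 : (1 : ℝ) ≤ |(g : ℝ)| := by exact_mod_cast Int.one_le_abs hg
      have h3 : |(g : ℝ)| * |(i : ℝ) - j| ≤ F := by
        rw [← abs_mul, abs_le]
        exact ⟨by linarith, h1⟩
      push_cast
      nlinarith [abs_nonneg ((i : ℝ) - j), le_abs_self ((i : ℝ) - j)])
    have hmemJ : ∀ n, n ∈ s ↔ ∃ x ∈ A, e (σ x) 0 = n := fun n => by
      rw [← Finset.mem_coe, hsJ]; rfl
    set τ : (Fin l → ℝ) →ᵃ[ℝ] (Fin (k + 1) → ℝ) := e.toLinearMap.toAffineMap.comp σ with hτ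
    set H : ℤ → AffineSubspace ℝ (Fin l → ℝ) := fun n =>
      (AffineSubspace.mk' (n : ℝ) ⊥).comap
        ((LinearMap.proj (R := ℝ) (φ := fun _ => ℝ) (0 : Fin (k + 1))).toAffineMap.comp τ) with hH
    have hHmem : ∀ n x, x ∈ H n ↔ e (σ x) 0 = n := fun n x => by
      rw [hH, AffineSubspace.mem_comap, AffineSubspace.mem_mk', Submodule.mem_bot, vsub_eq_sub,
        sub_eq_zero]
      rfl
    set ρ : (Fin l → ℝ) →ᵃ[ℝ] (Fin k → ℝ) :=
      (LinearMap.funLeft ℝ ℝ Fin.succ).toAffineMap.comp τ with hρ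
    have hρl : ∀ n x, x ∈ H n → (IsLatticePoint (ρ x) ↔ IsLatticePoint (σ x)) := by
      intro n x hx
      rw [← hlat]
      refine ⟨fun h i => Fin.cases ⟨n, (hHmem n x).1 hx⟩ (fun i => h i) i, fun h i => h i.succ⟩
    have hFk : (1 + δ) / δ * (flatnessConst k).toReal ≤ F := by
      refine le_trans (mul_le_mul_of_nonneg_left ?_ (div_nonneg (by linarith) hδ.le)) hF
      exact ENNReal.toReal_mono (flatnessConst_ne_top _) (flatnessConst_le_succ k)
    choose 𝓡 h𝓡 hcov hcard using fun n =>
      ih hFk (Q ∩ H n) (hQ.inter_affineSubspace (H n)) ρ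
    refine ⟨s.biUnion 𝓡, fun R hR => ?_, fun x hx => ?_, ?_⟩
    · obtain ⟨n, -, hR⟩ := Finset.mem_biUnion.1 hR
      refine ⟨(h𝓡 n R hR).1, (h𝓡 n R hR).2.mono ?_⟩
      rintro x ⟨⟨hxQ, hxH⟩, hxl⟩
      exact ⟨hxQ, (hρl n x hxH).1 hxl⟩
    · obtain ⟨n, hn⟩ := hcoord x hx
      have hxH := (hHmem n x).2 hn
      obtain ⟨R, hR, hxR⟩ := hcov n x ⟨⟨hx.1, hxH⟩, (hρl n x hxH).2 hx.2⟩
      exact ⟨R, Finset.mem_biUnion.2 ⟨n, (hmemJ n).2 ⟨x, hx, hn⟩, hR⟩, hxR⟩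
    · calc ((s.biUnion 𝓡).card : ℝ) ≤ ∑ n ∈ s, ((𝓡 n).card : ℝ) := by
            exact_mod_cast Finset.card_biUnion_le
        _ ≤ s.card • (1 + F) ^ k := Finset.sum_le_card_nsmul _ _ _ fun n _ => hcard n
        _ ≤ (1 + F) * (1 + F) ^ k := by
            rw [nsmul_eq_mul]
            exact mul_le_mul_of_nonneg_right hs (by positivity)
        _ = (1 + F) ^ (k + 1) := by ring

lemma isPolyhedronOfSize_of_fintype {ι κ : Type*} [Fintype κ] {m : ℕ} (hκ : Fintype.card κ ≤ m)
    (S : AffineSubspace ℝ (ι → ℝ)) (f : κ → (ι → ℝ) →ₗ[ℝ] ℝ) (b : κ → ℝ) :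
    IsPolyhedronOfSize ((S : Set (ι → ℝ)) ∩ {x | ∀ i, f i x ≤ b i}) m := by
  refine ⟨S, Fintype.card κ, hκ, fun i => f ((Fintype.equivFin κ).symm i),
    fun i => b ((Fintype.equivFin κ).symm i), ?_⟩
  congr 1
  ext x
  exact ((Fintype.equivFin κ).symm.forall_congr_right (q := fun i => f i x ≤ b i)).symm

lemma IsPolyhedronOfSize.preimage {ι ι' : Type*} {Q : Set (ι → ℝ)} {m : ℕ}
    (hQ : IsPolyhedronOfSize Q m) (L : (ι' → ℝ) →ₗ[ℝ] (ι → ℝ)) :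
    IsPolyhedronOfSize (L ⁻¹' Q) m := by
  obtain ⟨S, n, hn, f, b, rfl⟩ := hQ
  exact ⟨S.comap L.toAffineMap, n, hn, fun i => (f i).comp L, b, rfl⟩

/-- The ambient space of an extended formulation may be indexed by any finite type. -/
lemma exists_fin_extension {ι ι' : Type*} [Fintype ι'] {Q : Set (ι' → ℝ)} {m : ℕ}
    (hQ : IsPolyhedronOfSize Q m) (π : (ι' → ℝ) →ᵃ[ℝ] (ι → ℝ)) :
    ∃ (l : ℕ) (Q' : Set (Fin l → ℝ)) (π' : (Fin l → ℝ) →ᵃ[ℝ] (ι → ℝ)),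
      IsPolyhedronOfSize Q' m ∧ π' '' Q' = π '' Q := by
  set L := LinearEquiv.funCongrLeft ℝ ℝ (Fintype.equivFin ι') with hL
  refine ⟨_, L ⁻¹' Q, π.comp L.toLinearMap.toAffineMap, hQ.preimage L.toLinearMap, ?_⟩
  change (π ∘ L) '' (L ⁻¹' Q) = π '' Q
  rw [Set.image_comp, Set.image_preimage_eq _ L.surjective]

/-- If an affine-linear form `x ↦ φ (π x)` is bounded above by `M` on a nonempty polyhedron, then
its homogenization is bounded by `lam * M` on the homogenization of the polyhedron. -/
lemma homogenization_le {l n : ℕ} {ι : Type*} {S : AffineSubspace ℝ (Fin l → ℝ)}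
    {f : Fin n → (Fin l → ℝ) →ₗ[ℝ] ℝ} {b : Fin n → ℝ} {π : (Fin l → ℝ) →ᵃ[ℝ] (ι → ℝ)}
    {φ : (ι → ℝ) →ₗ[ℝ] ℝ} {M : ℝ} (hM : ∀ x ∈ S, (∀ i, f i x ≤ b i) → φ (π x) ≤ M)
    {r : Fin l → ℝ} (hrS : r ∈ S) (hr : ∀ i, f i r ≤ b i) {lam : ℝ} (hlam : 0 ≤ lam)
    {X : Fin l → ℝ} (hXS : X - lam • r ∈ S.direction) (hX : ∀ i, f i X ≤ lam * b i) :
    φ (π.linear X + lam • π 0) ≤ lam * M := by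
  have hπ : ∀ x, π x = π.linear x + π 0 := fun x => congrFun (AffineMap.decomp π) x
  rcases hlam.eq_or_lt with rfl | hpos
  · rw [zero_smul, sub_zero] at hXS
    rw [zero_smul, add_zero, zero_mul]
    by_contra! hcon
    have hray : ∀ t : ℝ, 0 ≤ t → t * φ (π.linear X) + φ (π r) ≤ M := by
      intro t ht
      have := hM (t • X + r)
        (AffineSubspace.vadd_mem_of_mem_direction (S.direction.smul_mem t hXS) hrS) (fun i => by
          have h1 := mul_nonpos_of_nonneg_of_nonpos ht (by simpa using hX i)
          rw [map_add, map_smul, smul_eq_mul]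
          linarith [hr i])
      rw [hπ, map_add π.linear, map_smul π.linear, add_assoc, ← hπ, map_add, map_smul,
        smul_eq_mul] at this
      exact this
    have h0 := hray 0 le_rfl
    have h1 := hray ((M - φ (π r) + 1) / φ (π.linear X)) (div_nonneg (by linarith) hcon.le)
    rw [div_mul_cancel₀ _ hcon.ne'] at h1
    linarith
  · have hx : X = lam • (lam⁻¹ • X) := by rw [smul_smul, mul_inv_cancel₀ hpos.ne', one_smul]
    have h := hM (lam⁻¹ • X) (by
        have h1 := AffineSubspace.vadd_mem_of_mem_direction (S.direction.smul_mem lam⁻¹ hXS) hrS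
        rw [smul_sub, smul_smul, inv_mul_cancel₀ hpos.ne', one_smul, vadd_eq_add,
          sub_add_cancel] at h1
        exact h1) (fun i => by
        rw [map_smul, smul_eq_mul, inv_mul_le_iff₀ hpos]
        exact hX i)
    have h2 : φ (π.linear X + lam • π 0) = lam * φ (π (lam⁻¹ • X)) := by
      conv_lhs => rw [hx]
      rw [hπ (lam⁻¹ • X), map_smul π.linear, ← smul_add, map_smul, smul_eq_mul]
    rw [h2]
    exact mul_le_mul_of_nonneg_left h hlam

/-- Balas' disjunctive programming: an extended formulation of a set between the convex hull of the
union of finitely many nonempty polyhedra and its closure. -/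
theorem exists_union_extension {l m : ℕ} {ι : Type*} (𝓡 : Finset (Set (Fin l → ℝ)))
    (h𝓡 : ∀ R ∈ 𝓡, IsPolyhedronOfSize R m) (hne : ∀ R ∈ 𝓡, R.Nonempty)
    (π : (Fin l → ℝ) →ᵃ[ℝ] (ι → ℝ)) :
    ∃ (l' : ℕ) (Q : Set (Fin l' → ℝ)) (π' : (Fin l' → ℝ) →ᵃ[ℝ] (ι → ℝ)),
      IsPolyhedronOfSize Q (𝓡.card * (m + 1)) ∧ (∀ R ∈ 𝓡, π '' R ⊆ π' '' Q) ∧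
      ∀ (φ : (ι → ℝ) →ₗ[ℝ] ℝ) (M : ℝ), (∀ R ∈ 𝓡, ∀ x ∈ R, φ (π x) ≤ M) →
        ∀ y ∈ π' '' Q, φ y ≤ M := by
  classical
  choose S n hn f b hR using fun R : 𝓡 => h𝓡 R R.2
  choose r hr using fun R : 𝓡 => hne R R.2
  have hmem : ∀ (R : 𝓡) (x : Fin l → ℝ), x ∈ R.1 ↔ x ∈ S R ∧ ∀ i, f R i x ≤ b R i :=
    fun R x => by
      conv_lhs => rw [hR R]
      rfl
  -- the blocks and the multipliers
  set X : 𝓡 → ((𝓡 × Fin l ⊕ 𝓡) → ℝ) →ₗ[ℝ] (Fin l → ℝ) :=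
    fun R => LinearMap.funLeft ℝ ℝ fun i => Sum.inl (R, i) with hX
  set lam : 𝓡 → ((𝓡 × Fin l ⊕ 𝓡) → ℝ) →ₗ[ℝ] ℝ := fun R => LinearMap.proj (Sum.inr R) with hlam
  set T : Submodule ℝ ((𝓡 × Fin l ⊕ 𝓡) → ℝ) :=
    ⨅ R, (S R).direction.comap (X R - (lam R).smulRight (r R)) with hT
  have hTmem : ∀ y, y ∈ T ↔ ∀ R, X R y - lam R y • r R ∈ (S R).direction := fun y => by
    simp [hT]
  set H : AffineSubspace ℝ ((𝓡 × Fin l ⊕ 𝓡) → ℝ) :=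
    T.toAffineSubspace ⊓ (AffineSubspace.mk' (1 : ℝ) ⊥).comap (∑ R, lam R).toAffineMap with hH
  have hHmem : ∀ y, y ∈ H ↔ y ∈ T ∧ ∑ R, lam R y = 1 := fun y => by
    rw [hH, AffineSubspace.mem_inf_iff, AffineSubspace.mem_comap, AffineSubspace.mem_mk',
      Submodule.mem_bot, vsub_eq_sub, sub_eq_zero, Submodule.mem_toAffineSubspace]
    simp
  set h : (Σ R : 𝓡, Option (Fin (n R))) → ((𝓡 × Fin l ⊕ 𝓡) → ℝ) →ₗ[ℝ] ℝ := fun i =>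
    i.2.elim (-(lam i.1)) fun j => (f i.1 j).comp (X i.1) - b i.1 j • lam i.1 with hh
  set Q : Set ((𝓡 × Fin l ⊕ 𝓡) → ℝ) := (H : Set _) ∩ {y | ∀ i, h i y ≤ (fun _ => 0) i} with hQ
  have hQmem : ∀ y, y ∈ Q ↔ ((∀ R, X R y - lam R y • r R ∈ (S R).direction) ∧
      ∑ R, lam R y = 1) ∧ (∀ R, 0 ≤ lam R y) ∧ ∀ R j, f R j (X R y) ≤ lam R y * b R j := by
    intro y
    rw [← hTmem, ← hHmem]
    refine and_congr_right fun _ => ⟨fun hy => ⟨fun R => ?_, fun R j => ?_⟩, ?_⟩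
    · have := hy ⟨R, none⟩
      simpa [hh] using this
    · have := hy ⟨R, some j⟩
      simp only [hh, Option.elim_some, LinearMap.sub_apply, LinearMap.comp_apply,
        LinearMap.smul_apply, smul_eq_mul] at this
      linarith
    · rintro ⟨h1, h2⟩ ⟨R, _ | j⟩
      · simpa [hh] using h1 R
      · have := h2 R j
        simp only [hh, Option.elim_some, LinearMap.sub_apply, LinearMap.comp_apply,
          LinearMap.smul_apply, smul_eq_mul]
        linarith
  have hcard : Fintype.card (Σ R : 𝓡, Option (Fin (n R))) ≤ 𝓡.card * (m + 1) := by
    rw [Fintype.card_sigma]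
    refine (Finset.sum_le_card_nsmul _ _ (m + 1) fun R _ => ?_).trans ?_
    · simpa using hn R
    · simp
  set p : ((𝓡 × Fin l ⊕ 𝓡) → ℝ) →ₗ[ℝ] (ι → ℝ) :=
    ∑ R, (π.linear.comp (X R) + (lam R).smulRight (π 0)) with hp
  have hpa : ∀ y, p y = ∑ R, (π.linear (X R y) + lam R y • π 0) := fun y => by
    simp [hp]
  have hpoly : IsPolyhedronOfSize Q (𝓡.card * (m + 1)) := isPolyhedronOfSize_of_fintype hcard H h _
  obtain ⟨l', Q', π', hQ', himg⟩ := exists_fin_extension hpoly p.toAffineMap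
  refine ⟨l', Q', π', hQ', ?_⟩
  rw [himg]
  refine ⟨fun R hR => ?_, ?_⟩
  · rintro _ ⟨x, hx, rfl⟩
    set R' : 𝓡 := ⟨R, hR⟩ with hR'
    set y : (𝓡 × Fin l ⊕ 𝓡) → ℝ := Sum.elim (fun a => if a.1 = R' then x a.2 else 0)
      (fun a => if a = R' then 1 else 0) with hy
    have hXy : ∀ a, X a y = if a = R' then x else 0 := fun a => by
      ext i
      by_cases ha : a = R' <;> simp [hX, hy, ha, LinearMap.funLeft_apply]
    have hly : ∀ a, lam a y = if a = R' then 1 else 0 := fun a => by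
      simp [hlam, hy]
    have hxR := (hmem R' x).1 hx
    refine ⟨y, (hQmem y).2 ⟨⟨fun a => ?_, ?_⟩, fun a => ?_, fun a j => ?_⟩, ?_⟩
    · rw [hXy, hly]
      by_cases ha : a = R'
      · subst ha
        simpa using AffineSubspace.vsub_mem_direction hxR.1 ((hmem _ _).1 (hr _)).1
      · simp [ha]
    · simp [hly]
    · rw [hly]; split_ifs <;> norm_num
    · rw [hXy, hly]
      by_cases ha : a = R'
      · subst ha
        simpa using hxR.2 j
      · simp [ha]
    · change p y = π x
      rw [hpa, Finset.sum_eq_single R']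
      · rw [hXy, hly, if_pos rfl, if_pos rfl, one_smul]
        exact (congrFun (AffineMap.decomp π) x).symm
      · intro a _ ha
        rw [hXy, hly, if_neg ha, if_neg ha, map_zero, zero_smul, add_zero]
      · simp
  · rintro φ M hM _ ⟨y, hy, rfl⟩
    obtain ⟨⟨hS, hsum⟩, hnn, hfb⟩ := (hQmem y).1 hy
    change φ (p y) ≤ M
    rw [hpa, map_sum]
    calc ∑ R, φ (π.linear (X R y) + lam R y • π 0) ≤ ∑ R, lam R y * M := by
          refine Finset.sum_le_sum fun R _ => ?_
          have hrR := (hmem R _).1 (hr R)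
          exact homogenization_le (fun x hx hxi => hM R R.2 x ((hmem R x).2 ⟨hx, hxi⟩))
            hrR.1 hrR.2 (hnn R) (hS R) (hfb R)
      _ = M := by rw [← Finset.sum_mul, hsum, one_mul]

/-- The distance from a point to a convex subset of the line is controlled by how far the point
exceeds the bounds of the set. -/
lemma iInf_ofReal_abs_sub_le {T : Set ℝ} (hT : T.OrdConnected) {lo hi c y : ℝ}
    (hlo : IsGLB T lo) (hhi : IsLUB T hi) (hc : 0 ≤ c) (h1 : lo - c ≤ y)
    (h2 : y ≤ hi + c) : ⨅ a ∈ T, ENNReal.ofReal |y - a| ≤ ENNReal.ofReal c := by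
  have key : (∀ t > 0, ∃ a ∈ T, |y - a| ≤ c + t) →
      ⨅ a ∈ T, ENNReal.ofReal |y - a| ≤ ENNReal.ofReal c := fun h => by
    refine ENNReal.le_of_forall_pos_le_add fun t ht _ => ?_
    obtain ⟨a, ha, hat⟩ := h t (by exact_mod_cast ht)
    calc ⨅ a ∈ T, ENNReal.ofReal |y - a| ≤ ENNReal.ofReal |y - a| := iInf₂_le a ha
      _ ≤ ENNReal.ofReal (c + t) := ENNReal.ofReal_le_ofReal hat
      _ = _ := by rw [ENNReal.ofReal_add hc t.coe_nonneg, ENNReal.ofReal_coe_nnreal]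
  refine key fun t ht => ?_
  rcases le_or_gt hi y with hy | hy
  · obtain ⟨a, ha, hat, hle⟩ := hhi.exists_between (sub_lt_self hi ht)
    exact ⟨a, ha, by rw [abs_le]; constructor <;> linarith⟩
  rcases le_or_gt y lo with hy' | hy'
  · obtain ⟨a, ha, hle, hat⟩ := hlo.exists_between (lt_add_of_pos_right lo ht)
    exact ⟨a, ha, by rw [abs_le]; constructor <;> linarith⟩
  · obtain ⟨a, ha, -, hat⟩ := hlo.exists_between hy'
    obtain ⟨a', ha', hat', -⟩ := hhi.exists_between hy
    exact ⟨y, hT.out ha ha' ⟨hat.le, hat'.le⟩, by rw [sub_self, abs_zero]; positivity⟩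

/-- A set whose linear forms are bounded in terms of those of a set at relative distance `ε` from
`C` is itself close to `C`. -/
lemma relDist_le_of_approximates {ι : Type*} {C A B : Set (ι → ℝ)} (hC : Convex ℝ C) {ε δ : ℝ}
    (hε : 0 ≤ ε) (hδ : 0 ≤ δ) (hA : relDist C A ≤ ENNReal.ofReal ε) (hB : Approximates δ A B) :
    relDist C B ≤ ENNReal.ofReal (ε + δ + 2 * ε * δ) := by
  have hη : 0 ≤ ε + δ + 2 * ε * δ := by positivity
  refine iSup_le fun φ => ?_
  have hφ := (le_iSup _ φ).trans hA
  rcases C.eq_empty_or_nonempty with rfl | hne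
  · have hAe : A = ∅ := by
      by_contra hA'
      obtain ⟨x, hx⟩ := Set.nonempty_iff_ne_empty.2 hA'
      have hbot : (⨆ b ∈ A, (⊤ : ℝ≥0∞)) = ⊤ := top_le_iff.1 (le_iSup₂_of_le x hx le_rfl)
      simp [hbot, ENNReal.div_zero] at hφ
    have hBe : B = ∅ := by
      refine Set.eq_empty_of_forall_notMem fun x hx => ?_
      have := hB 0 (-1) (-1) (fun a ha => by simp [hAe] at ha) x hx
      norm_num at this
    simp [hBe]
  set den := ⨆ a ∈ C, ⨆ a' ∈ C, ENNReal.ofReal |φ a - φ a'| with hden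
  rcases eq_or_ne den ⊤ with htop | htop
  · rw [htop, ENNReal.div_top]
    exact zero_le
  set D := den.toReal with hD
  have hD0 : 0 ≤ D := ENNReal.toReal_nonneg
  have hdenD : den = ENNReal.ofReal D := (ENNReal.ofReal_toReal htop).symm
  have hdiam : ∀ a ∈ C, ∀ a' ∈ C, |φ a - φ a'| ≤ D := fun a ha a' ha' => by
    rw [← ENNReal.ofReal_le_ofReal_iff hD0, ← hdenD]
    exact le_iSup₂_of_le a ha (le_iSup₂_of_le a' ha' le_rfl)
  obtain ⟨a₀, ha₀⟩ := hne
  have hneφ : (φ '' C).Nonempty := ⟨_, a₀, ha₀, rfl⟩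
  obtain ⟨hi, hhi⟩ : ∃ hi, IsLUB (φ '' C) hi := Real.exists_isLUB hneφ ⟨φ a₀ + D, by
    rintro _ ⟨a, ha, rfl⟩
    linarith [le_abs_self (φ a - φ a₀), hdiam a ha a₀ ha₀]⟩
  obtain ⟨lo, hlo⟩ : ∃ lo, IsGLB (φ '' C) lo := Real.exists_isGLB hneφ ⟨φ a₀ - D, by
    rintro _ ⟨a, ha, rfl⟩
    linarith [neg_abs_le (φ a - φ a₀), hdiam a ha a₀ ha₀]⟩
  have hwidth : hi - lo ≤ D := by
    rw [sub_le_comm]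
    refine hlo.2 ?_
    rintro _ ⟨a, ha, rfl⟩
    rw [sub_le_comm, sub_le_iff_le_add]
    refine hhi.2 ?_
    rintro _ ⟨a', ha', rfl⟩
    linarith [le_abs_self (φ a' - φ a), hdiam a' ha' a ha]
  rw [ENNReal.div_le_iff_le_mul (Or.inr ENNReal.ofReal_ne_top) (Or.inl htop), hdenD,
    ← ENNReal.ofReal_mul hε] at hφ
  rw [ENNReal.div_le_iff_le_mul (Or.inr ENNReal.ofReal_ne_top) (Or.inl htop), hdenD,
    ← ENNReal.ofReal_mul hη]
  have hbd : ∀ x ∈ A, lo - ε * D ≤ φ x ∧ φ x ≤ hi + ε * D := fun x hx => by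
    have hx' :=
      (le_iSup₂ (f := fun b (_ : b ∈ A) => ⨅ a ∈ C, ENNReal.ofReal |φ b - φ a|) x hx).trans hφ
    constructor
    · have : ENNReal.ofReal (lo - φ x) ≤ ENNReal.ofReal (ε * D) :=
        (le_iInf₂ fun a ha => ENNReal.ofReal_le_ofReal (by
          linarith [neg_abs_le (φ x - φ a), hlo.1 ⟨a, ha, rfl⟩])).trans hx'
      rw [ENNReal.ofReal_le_ofReal_iff (by positivity)] at this
      linarith
    · have : ENNReal.ofReal (φ x - hi) ≤ ENNReal.ofReal (ε * D) :=
        (le_iInf₂ fun a ha => ENNReal.ofReal_le_ofReal (by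
          linarith [le_abs_self (φ x - φ a), hhi.1 ⟨a, ha, rfl⟩])).trans hx'
      rw [ENNReal.ofReal_le_ofReal_iff (by positivity)] at this
      linarith
  have hδw := mul_le_mul_of_nonneg_left hwidth hδ
  refine iSup₂_le fun y hy => ?_
  have hup := hB φ _ _ hbd y hy
  have hdown := hB (-φ) (-(hi + ε * D)) (-(lo - ε * D))
    (fun a ha => ⟨neg_le_neg (hbd a ha).2, neg_le_neg (hbd a ha).1⟩) y hy
  rw [LinearMap.neg_apply] at hdown
  have := iInf_ofReal_abs_sub_le (hC.linear_image φ).ordConnected hlo hhi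
    (mul_nonneg hη hD0) (y := φ y) (by nlinarith) (by nlinarith)
  rwa [iInf_image] at this

lemma Approximates.image {E : Type*} {ι : Type*} [AddCommGroup E] [Module ℝ E] {δ : ℝ}
    {A R : Set E} (h : Approximates δ A R) (π : E →ᵃ[ℝ] (ι → ℝ)) :
    Approximates δ (π '' A) (π '' R) := by
  rintro φ lo hi hA _ ⟨x, hx, rfl⟩
  have hπ : ∀ x, φ (π x) = φ.comp π.linear x + φ (π 0) := fun x => by
    rw [LinearMap.comp_apply, ← map_add]
    exact congrArg φ (congrFun (AffineMap.decomp π) x)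
  have := h (φ.comp π.linear) (lo - φ (π 0)) (hi - φ (π 0)) (fun a ha => by
    have := hA _ ⟨a, ha, rfl⟩
    rw [hπ] at this
    constructor <;> linarith) x hx
  rw [hπ]
  linarith

/-- If a convex set `C ⊆ ℝ^d` has an `ε`-MILEF of complexity `(m,k)` with
`k ≥ 1`, then for every `δ > 0`, `C` has an `(ε + δ + 2εδ)`-LEF of size at most
`(m+1)·(1 + ((1+δ)/δ)·Flt(k))^k`. -/
theorem milef_to_lef_strong (d : ℕ) (C : Set (Fin d → ℝ)) (hC : Convex ℝ C)
    (ε : ℝ) (hε : 0 ≤ ε) (m k : ℕ) (hk : 1 ≤ k) (hmilef : IsMILEF C ε m k)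
    (δ : ℝ) (hδ : 0 < δ) :
    ∃ m' : ℕ, (m' : ℝ≥0∞) ≤ ((m : ℝ≥0∞) + 1) *
        (1 + ENNReal.ofReal ((1 + δ) / δ) * flatnessConst k) ^ k ∧
      IsLEF C (ε + δ + 2 * ε * δ) m' := by
  classical
  obtain ⟨l, Q, σ, π, hQ, hsub, hrd⟩ := hmilef
  set A := Q ∩ {x | IsLatticePoint (σ x)} with hA
  set F := (1 + δ) / δ * (flatnessConst k).toReal with hF
  have hF0 : 0 ≤ F := by positivity
  obtain ⟨𝓡₀, h𝓡₀, hcov, hcard⟩ := exists_slices hδ k hF.ge Q hQ σ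
  set 𝓡 := 𝓡₀.filter (·.Nonempty) with h𝓡
  have hmem : ∀ R ∈ 𝓡, R ∈ 𝓡₀ ∧ R.Nonempty := fun R hR => Finset.mem_filter.1 hR
  obtain ⟨l', Q', π', hQ', himg, hle⟩ := exists_union_extension 𝓡
    (fun R hR => (h𝓡₀ R (hmem R hR).1).1) (fun R hR => (hmem R hR).2) π
  refine ⟨𝓡.card * (m + 1), ?_, l', Q', π', hQ', ?_, ?_⟩
  · have hbase : 1 + ENNReal.ofReal ((1 + δ) / δ) * flatnessConst k = ENNReal.ofReal (1 + F) := by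
      rw [ENNReal.ofReal_add zero_le_one hF0, ENNReal.ofReal_one, hF,
        ENNReal.ofReal_mul (by positivity), ENNReal.ofReal_toReal (flatnessConst_ne_top k)]
    rw [hbase, ← ENNReal.ofReal_pow (by positivity), mul_comm]
    push_cast
    gcongr
    rw [← ENNReal.ofReal_natCast]
    refine ENNReal.ofReal_le_ofReal (le_trans ?_ hcard)
    exact_mod_cast Finset.card_filter_le _ _
  · refine hsub.trans (convexHull_min ?_ (hQ'.convex.affine_image π'))
    rintro _ ⟨x, hx, rfl⟩
    obtain ⟨R, hR, hxR⟩ := hcov x hx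
    exact himg R (Finset.mem_filter.2 ⟨hR, x, hxR⟩) ⟨x, hxR, rfl⟩
  · refine relDist_le_of_approximates hC hε hδ.le hrd fun φ lo hi hb y hy => ?_
    refine hle φ _ (fun R hR x hx => ?_) y hy
    exact ((h𝓡₀ R (hmem R hR).1).2.image π) φ lo hi
      (fun a ha => hb a (subset_convexHull ℝ _ ha)) _ ⟨x, hx, rfl⟩
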